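/- Let Ω, Σ be non-isotropic weights on ℝ^N built from weight functions, let 1 ≤ p, q ≤ ∞, and let f be a Schwartz function on ℝ^N. Then f ∈ S_Ω^Σ(ℝ^N) if and only if ‖e^{λΩ} f‖_{L^p} < ∞ for every λ > 0 and ‖e^{λΣ} f̂‖_{L^q} < ∞ for every λ > 0. -/

import Mathlib

open MeasureTheory Filter
open scoped ENNReal NNReal

noncomputable section

/-- Euclidean pairing `x·ξ = ∑ x_j ξ_j`. -/
def dotR {M : ℕ} (x ξ : Fin M → ℝ) : ℝ := ∑ j, x j * ξ j

/-- Fourier transform with kernel `e^{-i x·ξ}`. -/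
def FT {M : ℕ} (f : (Fin M → ℝ) → ℂ) (ξ : Fin M → ℝ) : ℂ :=
  ∫ x, Complex.exp (-(Complex.I * (dotR x ξ : ℂ))) * f x

/-- sup-norm (in `ℝ≥0∞`) of a complex-valued function. -/
def supNorm {M : ℕ} (f : (Fin M → ℝ) → ℂ) : ℝ≥0∞ := ⨆ x, (‖f x‖₊ : ℝ≥0∞)

/-- partial derivative `∂_j`. -/
def pD {M : ℕ} (j : Fin M) (f : (Fin M → ℝ) → ℂ) : (Fin M → ℝ) → ℂ :=
  fun x => fderiv ℝ f x (Pi.single j 1)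

/-- iterated partial derivative `∂^α`. -/
def pDpow {M : ℕ} (α : Fin M → ℕ) (f : (Fin M → ℝ) → ℂ) : (Fin M → ℝ) → ℂ :=
  ((List.ofFn fun j : Fin M => (pD j)^[α j]).foldr (· ∘ ·) id) f

/-- `D^α = (-i)^{|α|} ∂^α`. -/
def Dpow {M : ℕ} (α : Fin M → ℕ) (f : (Fin M → ℝ) → ℂ) : (Fin M → ℝ) → ℂ :=
  fun x => (-Complex.I) ^ (∑ j, α j) * pDpow α f x

/-- multiplication by the monomial `x^α`. -/
def monMul {M : ℕ} (α : Fin M → ℕ) (f : (Fin M → ℝ) → ℂ) : (Fin M → ℝ) → ℂ :=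
  fun x => ((∏ j, (x j) ^ (α j) : ℝ) : ℂ) * f x

/-- Weight function in the sense of the paper (extended to `ℝ` by `ω x = ω |x|`):
continuous, increasing on `[0,∞)`, nonnegative, together with conditions
(α), (β), (γ), (δ). -/
structure IsWeightFun (ω : ℝ → ℝ) : Prop where
  nonneg : ∀ x, 0 ≤ ω x
  eq_abs : ∀ x, ω x = ω |x|
  continuous : Continuous ω
  mono : MonotoneOn ω (Set.Ici 0)
  alphaCond : ∃ K, 1 ≤ K ∧ ∀ x, 0 ≤ x → ω (2 * x) ≤ K * (1 + ω x)
  betaCond : Filter.Tendsto (fun x => ω x / x) Filter.atTop (nhds 0)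
  gammaCond : ∃ a b : ℝ, 0 < b ∧ ∀ x, 0 ≤ x → a + b * Real.log (1 + x) ≤ ω x
  deltaCond : ConvexOn ℝ (Set.Ici 0) fun t => ω (Real.exp t)

/-- non-isotropic weight `Ω(x) = ω_1(x_1) + ⋯ + ω_M(x_M)`. -/
def wSum {M : ℕ} (ω : Fin M → ℝ → ℝ) (x : Fin M → ℝ) : ℝ := ∑ j, ω j (x j)

/-- Membership in the space `S_Ω^Σ(ℝ^M)`: `f ∈ L¹`, `f` and `f̂` smooth, and for
every `λ > 0` and every multi-index `α`, `‖e^{λΩ} D^α f‖_∞ < ∞` and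
`‖e^{λΣ} D^α f̂‖_∞ < ∞`. -/
structure MemS {M : ℕ} (Om Sig : (Fin M → ℝ) → ℝ) (f : (Fin M → ℝ) → ℂ) : Prop where
  integrable : Integrable f
  smooth : ContDiff ℝ (⊤ : ℕ∞) f
  smooth_ft : ContDiff ℝ (⊤ : ℕ∞) (FT f)
  decay : ∀ lam : ℝ, 0 < lam → ∀ α : Fin M → ℕ,
      supNorm (fun x => (Real.exp (lam * Om x) : ℂ) * Dpow α f x) < ⊤
  decay_ft : ∀ lam : ℝ, 0 < lam → ∀ α : Fin M → ℕ,
      supNorm (fun ξ => (Real.exp (lam * Sig ξ) : ℂ) * Dpow α (FT f) ξ) < ⊤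

/-- The properties of a non-isotropic weight used below: it is nonnegative, its values at points at
distance at most one are comparable, and it dominates `log (1 + ‖x‖)`. -/
structure IsTameWeight {M : ℕ} (Om : (Fin M → ℝ) → ℝ) : Prop where
  nonneg : ∀ x, 0 ≤ Om x
  comparable : ∃ K C : ℝ, 0 < K ∧ ∀ x y, ‖y - x‖ ≤ 1 → Om x ≤ K * Om y + C
  growth : ∃ m C : ℝ, 0 < m ∧ ∀ x, Real.log (1 + ‖x‖) ≤ m * Om x + C

/-- `e^{λΩ} h` is bounded for every `λ > 0`. -/
def IsRapidlyDecreasing {M : ℕ} (Om : (Fin M → ℝ) → ℝ) (h : (Fin M → ℝ) → ℂ) : Prop :=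
  ∀ lam : ℝ, 0 < lam → ∃ C : ℝ, ∀ x, Real.exp (lam * Om x) * ‖h x‖ ≤ C

theorem IsWeightFun.le_of_abs_sub_le {ω : ℝ → ℝ} (h : IsWeightFun ω) :
    ∃ K C : ℝ, 0 < K ∧ 0 ≤ C ∧ ∀ x y, |y - x| ≤ 1 → ω x ≤ K * ω y + C := by
  obtain ⟨K, hK, hd⟩ := h.alphaCond
  refine ⟨K, K + ω 2, by linarith, add_nonneg (by linarith) (h.nonneg 2), fun x y hxy => ?_⟩
  have hx : |x| ≤ |y| + 1 := by
    have := abs_sub_abs_le_abs_sub x y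
    rw [abs_sub_comm] at this
    linarith
  have hy := abs_nonneg y
  have h2 := h.nonneg 2
  have hdy := hd |y| hy
  rw [← h.eq_abs y] at hdy
  have hωy := h.nonneg y
  rw [h.eq_abs x]
  rcases le_total |y| 1 with h1 | h1
  · have : ω |x| ≤ ω 2 := h.mono (abs_nonneg x) (by simp) (by linarith)
    nlinarith
  · have : ω |x| ≤ ω (2 * |y|) :=
      h.mono (abs_nonneg x) (by simp) (by linarith)
    linarith

theorem IsWeightFun.log_le {ω : ℝ → ℝ} (h : IsWeightFun ω) :
    ∃ m C : ℝ, 0 ≤ m ∧ 0 ≤ C ∧ ∀ x, Real.log (1 + |x|) ≤ m * ω x + C := by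
  obtain ⟨a, b, hb, hab⟩ := h.gammaCond
  refine ⟨1 / b, |a| / b, by positivity, by positivity, fun x => ?_⟩
  have := hab |x| (abs_nonneg x)
  rw [← h.eq_abs x] at this
  rw [one_div_mul_eq_div, ← add_div, le_div_iff₀ hb]
  linarith [neg_abs_le a]

theorem isTameWeight_wSum {M : ℕ} {ω : Fin M → ℝ → ℝ} (hω : ∀ j, IsWeightFun (ω j)) :
    IsTameWeight (wSum ω) where
  nonneg x := Finset.sum_nonneg fun j _ => (hω j).nonneg _
  comparable := by
    choose K C hK hC hKC using fun j => (hω j).le_of_abs_sub_le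
    have hKs : ∀ j, K j ≤ ∑ i, K i := fun j =>
      Finset.single_le_sum (fun i _ => (hK i).le) (Finset.mem_univ j)
    refine ⟨1 + ∑ j, K j, ∑ j, C j,
      by linarith [Finset.sum_nonneg fun j (_ : j ∈ Finset.univ) => (hK j).le],
      fun x y hxy => ?_⟩
    rw [wSum, wSum, Finset.mul_sum, ← Finset.sum_add_distrib]
    refine Finset.sum_le_sum fun j _ => (hKC j (x j) (y j) ?_).trans ?_
    · exact (norm_le_pi_norm (y - x) j).trans hxy
    · gcongr
      · exact (hω j).nonneg _
      · linarith [hKs j]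
  growth := by
    choose m C hm hC hmC using fun j => (hω j).log_le
    have hms : 0 ≤ ∑ j, m j := Finset.sum_nonneg fun j _ => hm j
    have hCs : 0 ≤ ∑ j, C j := Finset.sum_nonneg fun j _ => hC j
    refine ⟨1 + ∑ j, m j, ∑ j, C j, by linarith, fun x => ?_⟩
    have hΩ : 0 ≤ wSum ω x := Finset.sum_nonneg fun j _ => (hω j).nonneg _
    have hrhs : 0 ≤ (1 + ∑ j, m j) * wSum ω x + ∑ j, C j := by positivity
    rw [Real.log_le_iff_le_exp (by positivity), ← le_sub_iff_add_le',
      pi_norm_le_iff_of_nonneg (by linarith [Real.one_le_exp hrhs])]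
    intro j
    rw [le_sub_iff_add_le', ← Real.log_le_iff_le_exp (by positivity)]
    refine (hmC j (x j)).trans (add_le_add (mul_le_mul ?_ ?_ ((hω j).nonneg _) (by linarith)) ?_)
    · linarith [Finset.single_le_sum (fun i _ => hm i) (Finset.mem_univ j)]
    · exact Finset.single_le_sum (f := fun i => ω i (x i)) (fun i _ => (hω i).nonneg _)
        (Finset.mem_univ j)
    · exact Finset.single_le_sum (fun i _ => hC i) (Finset.mem_univ j)

theorem supNorm_lt_top_iff {M : ℕ} (h : (Fin M → ℝ) → ℂ) :
    supNorm h < ⊤ ↔ ∃ C : ℝ, ∀ x, ‖h x‖ ≤ C := by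
  constructor
  · intro hh
    refine ⟨(supNorm h).toReal, fun x => ?_⟩
    have : (‖h x‖₊ : ℝ≥0∞) ≤ supNorm h := le_iSup (fun x => (‖h x‖₊ : ℝ≥0∞)) x
    simpa using ENNReal.toReal_mono hh.ne this
  · rintro ⟨C, hC⟩
    refine lt_of_le_of_lt (iSup_le fun x => ?_) (ENNReal.ofReal_lt_top (r := C))
    rw [← enorm_eq_nnnorm, ← ofReal_norm]
    exact ENNReal.ofReal_le_ofReal (hC x)

theorem norm_exp_mul {a : ℝ} (z : ℂ) : ‖(Real.exp a : ℂ) * z‖ = Real.exp a * ‖z‖ := by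
  rw [norm_mul, Complex.norm_real, Real.norm_of_nonneg (Real.exp_nonneg a)]

theorem SchwartzMap.exists_lipschitz {E F : Type*} [NormedAddCommGroup E] [NormedSpace ℝ E]
    [NormedAddCommGroup F] [NormedSpace ℝ F] (g : SchwartzMap E F) :
    ∃ L : ℝ, 0 ≤ L ∧ ∀ x y, ‖g y - g x‖ ≤ L * ‖y - x‖ := by
  refine ⟨SchwartzMap.seminorm ℝ 0 0 (SchwartzMap.fderivCLM ℝ E F g), apply_nonneg _ _,
    fun x y => Convex.norm_image_sub_le_of_norm_fderiv_le (𝕜 := ℝ) (s := Set.univ)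
      (fun x _ => g.differentiableAt) (fun x _ => ?_) convex_univ trivial trivial⟩
  exact SchwartzMap.norm_le_seminorm ℝ (SchwartzMap.fderivCLM ℝ E F g) x

/-- A Schwartz function whose products with `e^{λΩ}` lie in `L^p` decreases rapidly with respect to
`Ω`: the Lipschitz bound keeps `|g|` above `|g x| / 2` on a ball of radius proportional
to `|g x|`. -/
theorem IsTameWeight.isRapidlyDecreasing_of_eLpNorm {M : ℕ} {Om : (Fin M → ℝ) → ℝ}
    (hOm : IsTameWeight Om) {p : ℝ≥0∞} (hp : 1 ≤ p) (g : SchwartzMap (Fin M → ℝ) ℂ)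
    (hg : ∀ lam : ℝ, 0 < lam →
      eLpNorm (fun x => (Real.exp (lam * Om x) : ℂ) * g x) p volume < ⊤) :
    IsRapidlyDecreasing Om g := by
  intro lam hlam
  obtain ⟨K, C, hK, hKC⟩ := hOm.comparable
  obtain ⟨L₀, hL₀, hLip⟩ := g.exists_lipschitz
  set S := SchwartzMap.seminorm ℝ 0 0 g
  have hS : 0 ≤ S := apply_nonneg _ _
  have hbd : ∀ x, ‖g x‖ ≤ S := SchwartzMap.norm_le_seminorm ℝ g
  set L := 1 + L₀ + S
  have hL : 0 < L := by positivity
  set B := eLpNorm (fun x => (Real.exp (lam * (M + 1) * K * Om x) : ℂ) * g x) p volume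
  have hB : B < ⊤ := hg _ (by positivity)
  set D := 2 * L ^ M * Real.exp (lam * (M + 1) * C) * B.toReal
  have hD : 0 ≤ D := by positivity
  refine ⟨1 + D, fun x => ?_⟩
  rcases (norm_nonneg (g x)).eq_or_lt with h0 | h0
  · rw [← h0]; linarith
  set h := ‖g x‖
  have hhL : h / L ≤ 1 := (div_le_one hL).2 ((hbd x).trans (by simp only [L]; linarith))
  set r := h / L / 2
  have hr : 0 < r := by positivity
  set c := Real.exp (lam * (M + 1) * (Om x - C)) * (h / 2)
  have hc : 0 < c := by positivity
  have hball : ∀ y ∈ Metric.ball x r, c ≤ Real.exp (lam * (M + 1) * K * Om y) * ‖g y‖ := by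
    intro y hy
    have hyr : ‖y - x‖ < r := by simpa [dist_eq_norm] using hy
    refine mul_le_mul ?_ ?_ (by positivity) (Real.exp_nonneg _)
    · rw [Real.exp_le_exp, mul_assoc _ K]
      have := hKC x y (by simp only [r] at hyr; linarith)
      gcongr
      linarith
    · have h1 := hLip x y
      have h2 : L₀ * ‖y - x‖ ≤ L * r := by
        gcongr
        simp only [L]; linarith
      have h3 : L * r = h / 2 := by simp only [r]; field_simp
      have h4 := norm_sub_norm_le (g x) (g y)
      rw [norm_sub_rev] at h4
      linarith
  have hvol : volume (Metric.ball x r) = ENNReal.ofReal ((h / L) ^ M) := by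
    rw [Real.volume_pi_ball _ hr, Fintype.card_fin, mul_div_cancel₀ _ two_ne_zero]
  have hle : ENNReal.ofReal c * ENNReal.ofReal ((h / L) ^ M) ≤ B := by
    calc ENNReal.ofReal c * ENNReal.ofReal ((h / L) ^ M)
        ≤ ‖c‖ₑ * volume (Metric.ball x r) ^ (1 / p.toReal) := by
          rw [hvol, Real.enorm_of_nonneg hc.le]
          gcongr
          refine (ENNReal.rpow_one _).symm.trans_le (ENNReal.rpow_le_rpow_of_exponent_ge
            (ENNReal.ofReal_le_one.2 (pow_le_one₀ (by positivity) hhL)) ?_)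
          rcases eq_or_ne p ⊤ with rfl | hp'
          · simp
          · have : 1 ≤ p.toReal := by simpa using ENNReal.toReal_mono hp' hp
            exact (div_le_one (by linarith)).2 this
      _ = eLpNorm ((Metric.ball x r).indicator fun _ => c) p volume :=
          (eLpNorm_indicator_const' Metric.isOpen_ball.measurableSet
            (Metric.measure_ball_pos _ _ hr).ne' (by positivity)).symm
      _ ≤ B := by
          refine eLpNorm_mono fun y => ?_
          rw [norm_exp_mul]
          by_cases hy : y ∈ Metric.ball x r
          · rw [Set.indicator_of_mem hy, Real.norm_of_nonneg hc.le]
            exact hball y hy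
          · rw [Set.indicator_of_notMem hy, norm_zero]
            positivity
  have hreal : c * (h / L) ^ M ≤ B.toReal := by
    rw [← ENNReal.ofReal_mul hc.le] at hle
    exact (ENNReal.ofReal_le_iff_le_toReal hB.ne).1 hle
  have hpow : (Real.exp (lam * Om x) * h) ^ (M + 1) ≤ D := by
    have : (Real.exp (lam * Om x) * h) ^ (M + 1)
        = 2 * L ^ M * Real.exp (lam * (M + 1) * C) * (c * (h / L) ^ M) := by
      simp only [c]
      rw [mul_pow, ← Real.exp_nat_mul, mul_sub, Real.exp_sub, div_pow, pow_succ]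
      push_cast
      rw [show ((M : ℝ) + 1) * (lam * Om x) = lam * (M + 1) * Om x by ring]
      field_simp
    rw [this]
    exact mul_le_mul_of_nonneg_left hreal (by positivity)
  rcases le_total (Real.exp (lam * Om x) * h) 1 with h1 | h1
  · linarith
  · have := le_self_pow₀ h1 (Nat.add_one_ne_zero M)
    linarith

theorem IsTameWeight.eLpNorm_lt_top_of_isRapidlyDecreasing {M : ℕ} {Om : (Fin M → ℝ) → ℝ}
    (hOm : IsTameWeight Om) (p : ℝ≥0∞) {h : (Fin M → ℝ) → ℂ} (hh : IsRapidlyDecreasing Om h)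
    {lam : ℝ} (hlam : 0 < lam) :
    eLpNorm (fun x => (Real.exp (lam * Om x) : ℂ) * h x) p volume < ⊤ := by
  obtain ⟨m, C, hm, hmC⟩ := hOm.growth
  obtain ⟨k, hk⟩ := (inferInstance :
    (volume : Measure (Fin M → ℝ)).HasTemperateGrowth).exists_eLpNorm_lt_top p
  obtain ⟨A, hA⟩ := hh (lam + k * m) (by positivity)
  refine lt_of_le_of_lt (eLpNorm_le_mul_eLpNorm_of_ae_le_mul (g := fun x => (1 + ‖x‖) ^ (-k : ℝ))
    (c := Real.exp (k * C) * A) (ae_of_all _ fun x => ?_) p)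
    (ENNReal.mul_lt_top ENNReal.ofReal_lt_top hk)
  have h1 : 0 < 1 + ‖x‖ := by positivity
  rw [norm_exp_mul, Real.norm_of_nonneg (by positivity), Real.rpow_def_of_pos h1]
  have hlog : (k : ℝ) * Real.log (1 + ‖x‖) ≤ k * (m * Om x + C) := by gcongr; exact hmC x
  calc Real.exp (lam * Om x) * ‖h x‖
      = Real.exp (-(k * m * Om x)) * (Real.exp ((lam + k * m) * Om x) * ‖h x‖) := by
        rw [← mul_assoc, ← Real.exp_add]; ring_nf
    _ ≤ Real.exp (k * C + Real.log (1 + ‖x‖) * -k) * A := by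
        refine mul_le_mul (Real.exp_le_exp.2 (by linarith)) (hA x) (by positivity)
          (Real.exp_nonneg _)
    _ = _ := by rw [Real.exp_add]; ring

/-- Rapid decrease of a Schwartz function passes to its partial derivatives: apply Taylor's formula
with step `e^{-λΩ(x)}`. -/
theorem IsTameWeight.isRapidlyDecreasing_pD {M : ℕ} {Om : (Fin M → ℝ) → ℝ}
    (hOm : IsTameWeight Om) (g : SchwartzMap (Fin M → ℝ) ℂ) (hg : IsRapidlyDecreasing Om g)
    (j : Fin M) : IsRapidlyDecreasing Om (pD j g) := by
  intro lam hlam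
  obtain ⟨K, C, hK, hKC⟩ := hOm.comparable
  obtain ⟨L, hL, hLip⟩ := (SchwartzMap.fderivCLM ℝ (Fin M → ℝ) ℂ g).exists_lipschitz
  simp only [SchwartzMap.fderivCLM_apply] at hLip
  obtain ⟨A₀, hA₀⟩ := hg (2 * lam) (by positivity)
  obtain ⟨A₁, hA₁⟩ := hg (2 * lam * K) (by positivity)
  refine ⟨Real.exp (2 * lam * C) * A₁ + A₀ + L, fun x => ?_⟩
  set t := Real.exp (-(lam * Om x))
  have ht : 0 < t := Real.exp_pos _
  have ht1 : t ≤ 1 := Real.exp_le_one_iff.2 (neg_nonpos.2 (mul_nonneg hlam.le (hOm.nonneg x)))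
  set e : Fin M → ℝ := Pi.single j 1
  have he : ‖e‖ = 1 := by simp [e, Pi.norm_single]
  set y := x + t • e
  have hyx : y - x = t • e := by simp [y]
  have hnyx : ‖y - x‖ = t := by rw [hyx, norm_smul, he, Real.norm_of_nonneg ht.le, mul_one]
  have htay : ‖g y - g x - fderiv ℝ g x (y - x)‖ ≤ L * t * ‖y - x‖ := by
    refine Convex.norm_image_sub_le_of_norm_fderiv_le' (𝕜 := ℝ) (s := Metric.closedBall x t)
      (fun z _ => g.differentiableAt) (fun z hz => (hLip x z).trans ?_)
      (convex_closedBall x t) (Metric.mem_closedBall_self ht.le) (by simp [dist_eq_norm, hnyx])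
    have : ‖z - x‖ ≤ t := by simpa [dist_eq_norm] using hz
    gcongr
  rw [hnyx, hyx, map_smul] at htay
  change _ * ‖fderiv ℝ g x e‖ ≤ _
  set d := fderiv ℝ g x e
  have hd : t * ‖d‖ ≤ ‖g y‖ + ‖g x‖ + L * t * t := by
    have h1 : t * ‖d‖ = ‖t • d‖ := by rw [norm_smul, Real.norm_of_nonneg ht.le]
    have h2 := norm_sub_norm_le (t • d) (g y - g x)
    rw [norm_sub_rev (t • d)] at h2
    have h3 := norm_sub_le (g y) (g x)
    linarith
  have hE : Real.exp (lam * Om x) * t = 1 := by rw [← Real.exp_add]; simp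
  have hE2 : Real.exp (2 * lam * Om x) = Real.exp (lam * Om x) * Real.exp (lam * Om x) := by
    rw [← Real.exp_add]; ring_nf
  have hy : Real.exp (2 * lam * Om x) * ‖g y‖ ≤ Real.exp (2 * lam * C) * A₁ := by
    refine le_trans ?_ (mul_le_mul_of_nonneg_left (hA₁ y) (Real.exp_nonneg _))
    rw [← mul_assoc, ← Real.exp_add]
    gcongr
    have := hKC x y (hnyx.trans_le ht1)
    nlinarith
  have key : Real.exp (lam * Om x) * ‖d‖
      ≤ Real.exp (2 * lam * Om x) * ‖g y‖ + Real.exp (2 * lam * Om x) * ‖g x‖ + L := by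
    calc Real.exp (lam * Om x) * ‖d‖
        = Real.exp (2 * lam * Om x) * (t * ‖d‖) := by
          rw [hE2]; linear_combination (-(Real.exp (lam * Om x) * ‖d‖)) * hE
      _ ≤ Real.exp (2 * lam * Om x) * (‖g y‖ + ‖g x‖ + L * t * t) := by gcongr
      _ = _ := by
          rw [hE2]
          linear_combination L * (Real.exp (lam * Om x) * t + 1) * hE
  linarith [hA₀ x]

theorem IsTameWeight.isRapidlyDecreasing_pDpow {M : ℕ} {Om : (Fin M → ℝ) → ℝ}
    (hOm : IsTameWeight Om) (g : SchwartzMap (Fin M → ℝ) ℂ) (hg : IsRapidlyDecreasing Om g)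
    (α : Fin M → ℕ) : IsRapidlyDecreasing Om (pDpow α g) := by
  let P : ((Fin M → ℝ) → ℂ) → Prop := fun h =>
    ∃ k : SchwartzMap (Fin M → ℝ) ℂ, ⇑k = h ∧ IsRapidlyDecreasing Om h
  have hpD : ∀ j h, P h → P (pD j h) := by
    rintro j _ ⟨k, rfl, hk⟩
    exact ⟨LineDeriv.lineDerivOp (Pi.single j 1) k,
      funext fun x => SchwartzMap.lineDerivOp_apply_eq_fderiv _ _ _,
      hOm.isRapidlyDecreasing_pD k hk j⟩
  have hiter : ∀ j n h, P h → P ((pD j)^[n] h) := by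
    intro j n
    induction n with
    | zero => exact fun h hh => hh
    | succ n ih => exact fun h hh => ih _ (hpD j h hh)
  have hfold : ∀ l : List (((Fin M → ℝ) → ℂ) → (Fin M → ℝ) → ℂ),
      (∀ T ∈ l, ∀ h, P h → P (T h)) → ∀ h, P h → P (l.foldr (· ∘ ·) id h) := by
    intro l
    induction l with
    | nil => exact fun _ h hh => hh
    | cons T l ih =>
      intro hl h hh
      exact hl T List.mem_cons_self _
        (ih (fun S hS => hl S (List.mem_cons_of_mem _ hS)) h hh)
  obtain ⟨_, _, h⟩ := hfold (List.ofFn fun j : Fin M => (pD j)^[α j]) (by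
    intro T hT
    obtain ⟨j, rfl⟩ := (List.mem_ofFn' _ _).1 hT
    exact hiter j (α j)) g ⟨g, rfl, hg⟩
  exact h

theorem pDpow_zero {M : ℕ} (h : (Fin M → ℝ) → ℂ) : pDpow 0 h = h := by
  have : ∀ l : List (((Fin M → ℝ) → ℂ) → (Fin M → ℝ) → ℂ),
      (∀ T ∈ l, T = id) → l.foldr (· ∘ ·) id = id := by
    intro l
    induction l with
    | nil => exact fun _ => rfl
    | cons T l ih =>
      intro hl
      rw [List.foldr_cons, hl T List.mem_cons_self,
        ih fun S hS => hl S (List.mem_cons_of_mem _ hS), Function.id_comp]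
  rw [pDpow, this]
  · rfl
  · intro T hT
    obtain ⟨j, rfl⟩ := (List.mem_ofFn' _ _).1 hT
    rfl

theorem supNorm_exp_mul_Dpow_lt_top_iff {M : ℕ} (Om : (Fin M → ℝ) → ℝ) (lam : ℝ) (α : Fin M → ℕ)
    (h : (Fin M → ℝ) → ℂ) :
    supNorm (fun x => (Real.exp (lam * Om x) : ℂ) * Dpow α h x) < ⊤ ↔
      ∃ C : ℝ, ∀ x, Real.exp (lam * Om x) * ‖pDpow α h x‖ ≤ C := by
  simp only [supNorm_lt_top_iff, norm_exp_mul]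
  simp only [Dpow, norm_mul, norm_pow, norm_neg, Complex.norm_I, one_pow, one_mul]

theorem IsTameWeight.decay_iff_eLpNorm {M : ℕ} {Om : (Fin M → ℝ) → ℝ}
    (hOm : IsTameWeight Om) {p : ℝ≥0∞} (hp : 1 ≤ p) (g : SchwartzMap (Fin M → ℝ) ℂ) :
    (∀ lam : ℝ, 0 < lam → ∀ α : Fin M → ℕ,
        supNorm (fun x => (Real.exp (lam * Om x) : ℂ) * Dpow α g x) < ⊤) ↔
      ∀ lam : ℝ, 0 < lam →
        eLpNorm (fun x => (Real.exp (lam * Om x) : ℂ) * g x) p volume < ⊤ := by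
  simp only [supNorm_exp_mul_Dpow_lt_top_iff]
  constructor
  · intro h lam hlam
    refine hOm.eLpNorm_lt_top_of_isRapidlyDecreasing p (fun l hl => ?_) hlam
    simpa only [pDpow_zero] using h l hl 0
  · intro h lam hlam α
    exact hOm.isRapidlyDecreasing_pDpow g (hOm.isRapidlyDecreasing_of_eLpNorm hp g h) α lam hlam

/-- `FT` maps Schwartz functions to Schwartz functions. -/
theorem exists_schwartzMap_eq_FT {M : ℕ} (f : SchwartzMap (Fin M → ℝ) ℂ) :
    ∃ g : SchwartzMap (Fin M → ℝ) ℂ, ⇑g = FT f := by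
  let e : EuclideanSpace ℝ (Fin M) ≃L[ℝ] (Fin M → ℝ) := EuclideanSpace.equiv (Fin M) ℝ
  let s : (Fin M → ℝ) ≃L[ℝ] (Fin M → ℝ) :=
    ContinuousLinearEquiv.smulLeft (Units.mk0 ((2 * Real.pi)⁻¹ : ℝ) (by positivity))
  let F := FourierTransform.fourier (SchwartzMap.compCLMOfContinuousLinearEquiv ℝ e f)
  refine ⟨SchwartzMap.compCLMOfContinuousLinearEquiv ℝ (s.trans e.symm) F, funext fun ξ => ?_⟩
  rw [SchwartzMap.compCLMOfContinuousLinearEquiv_apply, Function.comp_apply,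
    SchwartzMap.fourier_coe, Real.fourier_eq', FT,
    ← (PiLp.volume_preserving_ofLp (Fin M)).integral_comp
      (MeasurableEquiv.toLp 2 _).symm.measurableEmbedding]
  refine integral_congr_ae (ae_of_all _ fun x => ?_)
  have hinner : inner ℝ x ((s.trans e.symm) ξ) = (2 * Real.pi)⁻¹ * dotR x.ofLp ξ := by
    rw [PiLp.inner_apply, dotR, Finset.mul_sum]
    refine Finset.sum_congr rfl fun j _ => ?_
    change (2 * Real.pi)⁻¹ * ξ j * x.ofLp j = _
    ring
  have hexp : -2 * Real.pi * ((2 * Real.pi)⁻¹ * dotR x.ofLp ξ) = -dotR x.ofLp ξ := by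
    field_simp
  change Complex.exp _ * f x.ofLp = Complex.exp _ * f x.ofLp
  rw [hinner, hexp]
  congr 2
  push_cast
  ring

/-- A Schwartz function belongs to `S_Ω^Σ` if and only if its weighted `L^p`
norms and the weighted `L^q` norms of its Fourier transform are finite
(equivalence (1) ⇔ (3) of Theorem 2.11 of the paper). -/
theorem statement_7 (N : ℕ) (ω σ : Fin N → ℝ → ℝ)
    (hω : ∀ j, IsWeightFun (ω j)) (hσ : ∀ j, IsWeightFun (σ j))
    (p q : ℝ≥0∞) (hp : 1 ≤ p) (hq : 1 ≤ q)
    (f : SchwartzMap ((Fin N → ℝ)) ℂ) :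
    MemS (wSum ω) (wSum σ) (⇑f) ↔
      ((∀ lam : ℝ, 0 < lam →
          eLpNorm (fun x => (Real.exp (lam * wSum ω x) : ℂ) * f x) p volume < ⊤) ∧
       (∀ lam : ℝ, 0 < lam →
          eLpNorm (fun ξ => (Real.exp (lam * wSum σ ξ) : ℂ) * FT (⇑f) ξ) q volume < ⊤)) := by
  obtain ⟨g, hg⟩ := exists_schwartzMap_eq_FT f
  rw [← (isTameWeight_wSum hω).decay_iff_eLpNorm hp f, ← hg,
    ← (isTameWeight_wSum hσ).decay_iff_eLpNorm hq g]
  constructor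
  · intro h
    exact ⟨h.decay, fun lam hlam α => hg ▸ h.decay_ft lam hlam α⟩
  · rintro ⟨h₁, h₂⟩
    rw [hg] at h₂
    exact ⟨f.integrable, f.smooth _, hg ▸ g.smooth _, h₁, h₂⟩

end
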